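/- arXiv:2503.01246 — 3 statements merged into one kernel-verified Lean document; each statement's English description precedes it below -/
import Mathlib

section
/- For every integer m ≥ 0 and all real s, t, the identity P_{m+1}(s,t) = (s² + t²) · ∂_s P_m(s,t) − (2m+1) s · P_m(s,t) holds, where ∂_s P_m denotes the derivative of the function s ↦ P_m(s,t). -/
open Finset

/-- The even-index coefficients `a_{2m,2i}`. -/
noncomputable def aEven (m i : ℕ) : ℝ :=
  (-1 : ℝ) ^ (m - i) * (2 : ℝ) ^ ((2 * (i : ℤ)) - 2 * (m : ℤ)) *
    (Nat.factorial (2 * m) : ℝ) * (Nat.choose (2 * m) (m - i) : ℝ) *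
    (Nat.choose (m + i) (m - i) : ℝ)

/-- The odd-index coefficients `a_{2m+1,2i+1}`. -/
noncomputable def aOdd (m i : ℕ) : ℝ :=
  (-1 : ℝ) ^ (m - i + 1) * (2 : ℝ) ^ ((2 * (i : ℤ)) - 2 * (m : ℤ)) *
    (Nat.factorial (2 * m + 1) : ℝ) * (Nat.choose (2 * m + 1) (m - i) : ℝ) *
    (Nat.choose (m + i + 1) (m - i) : ℝ)

/-- The polynomials `P_n(s,t)`: for `n = 2m`, `P_{2m}(s,t) = Σ a_{2m,2i} s^{2i} t^{2(m-i)}`,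
and for `n = 2m+1`, `P_{2m+1}(s,t) = Σ a_{2m+1,2i+1} s^{2i+1} t^{2(m-i)}`. -/
noncomputable def Ppoly (n : ℕ) (s t : ℝ) : ℝ :=
  if n % 2 = 0 then
    ∑ i ∈ Finset.range (n / 2 + 1), aEven (n / 2) i * s ^ (2 * i) * t ^ (2 * (n / 2 - i))
  else
    ∑ i ∈ Finset.range (n / 2 + 1), aOdd (n / 2) i * s ^ (2 * i + 1) * t ^ (2 * (n / 2 - i))


noncomputable def cc (n j : ℕ) : ℝ :=
  (-1 : ℝ) ^ (n + j) * (1 / 4 : ℝ) ^ j * (Nat.factorial n : ℝ) * (Nat.choose n j : ℝ) *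
    (Nat.choose (n - j) j : ℝ)

lemma cc_zero {n j : ℕ} (h : n < 2 * j) : cc n j = 0 := by
  unfold cc
  rw [Nat.choose_eq_zero_of_lt (show n - j < j by omega)]
  simp

lemma cc_closed (k j : ℕ) : cc (2 * j + k) j =
    (-1 : ℝ) ^ (k + j) * (1 / 4 : ℝ) ^ j * (Nat.factorial (2 * j + k) : ℝ) ^ 2 /
      ((Nat.factorial j : ℝ) ^ 2 * (Nat.factorial k : ℝ)) := by
  unfold cc
  have e1 : 2 * j + k - j = j + k := by omega
  have e2 : 2 * j + k = j + (j + k) := by omega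
  have h1 := Nat.add_choose_mul_factorial_mul_factorial j (j + k)
  have h2 := Nat.add_choose_mul_factorial_mul_factorial j k
  have h3 : (-1 : ℝ) ^ (2 * j + k + j) = (-1 : ℝ) ^ (k + j) := by
    rw [show 2 * j + k + j = 2 * j + (k + j) by ring, pow_add, pow_mul]; simp
  rw [h3, e1, e2]
  have f1 : (Nat.factorial j : ℝ) ≠ 0 := by positivity
  have f2 : (Nat.factorial k : ℝ) ≠ 0 := by positivity
  rw [eq_div_iff (by positivity)]
  have h1' : ((j + (j + k)).choose j : ℝ) * j.factorial * (j + k).factorial =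
    (j + (j + k)).factorial := by rw [Nat.choose_symm_add]; exact_mod_cast h1
  have h2' : ((j + k).choose j : ℝ) * j.factorial * k.factorial =
    (j + k).factorial := by rw [Nat.choose_symm_add]; exact_mod_cast h2
  rw [sq ((j + (j + k)).factorial : ℝ)]
  nth_rewrite 3 [← h1']
  rw [← h2']
  ring

lemma cc_rec0 (n : ℕ) : cc (n + 1) 0 = -((n : ℝ) + 1) * cc n 0 := by
  simp [cc, Nat.factorial_succ, pow_succ]
  ring

lemma cc_rec (n j : ℕ) : cc (n + 1) (j + 1) =
    -((n : ℝ) + 2 * j + 3) * cc n (j + 1) + ((n : ℝ) - 2 * j) * cc n j := by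
  rcases lt_or_ge n (2 * j) with h | h
  · rw [cc_zero h, cc_zero (by omega), cc_zero (by omega)]; simp
  obtain ⟨k, rfl⟩ := Nat.exists_eq_add_of_le h
  rcases k with _ | _ | k
  · rw [cc_zero (n := 2 * j + 0 + 1) (by omega), cc_zero (n := 2 * j + 0) (j := j + 1) (by omega)]
    simp
  · rw [cc_zero (n := 2 * j + (0 + 1)) (j := j + 1) (by omega), cc_closed,
      show 2 * j + (0 + 1) + 1 = 2 * (j + 1) + 0 by ring, cc_closed,
      show 2 * (j + 1) + 0 = 2 * j + (0 + 1) + 1 by ring]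
    have f1 : (Nat.factorial j : ℝ) ≠ 0 := by positivity
    simp only [Nat.factorial_succ (2 * j + (0 + 1)), Nat.factorial_succ j]
    push_cast
    simp only [pow_succ, pow_add]
    have : (j : ℝ) + 1 ≠ 0 := by positivity
    field_simp
    simp
    ring
  · rw [cc_closed, show 2 * j + (k + 1 + 1) + 1 = 2 * (j + 1) + (k + 1) by ring, cc_closed,
      show 2 * j + (k + 1 + 1) = 2 * (j + 1) + k by ring, cc_closed,
      show 2 * (j + 1) + (k + 1) = 2 * (j + 1) + k + 1 by ring]
    have f1 : (Nat.factorial j : ℝ) ≠ 0 := by positivity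
    have f2 : (Nat.factorial k : ℝ) ≠ 0 := by positivity
    simp only [Nat.factorial_succ (2 * (j + 1) + k), Nat.factorial_succ j, Nat.factorial_succ k,
      Nat.factorial_succ (k + 1)]
    generalize ((2 * (j + 1) + k).factorial) = F
    push_cast
    simp only [pow_succ, pow_add]
    have : (j : ℝ) + 1 ≠ 0 := by positivity
    have : (k : ℝ) + 1 ≠ 0 := by positivity
    have : (k : ℝ) + 1 + 1 ≠ 0 := by positivity
    field_simp
    ring

lemma two_zpow_aux (m i j : ℕ) (h : i + j = m) :
    (2 : ℝ) ^ ((2 * (i : ℤ)) - 2 * (m : ℤ)) = (1 / 4 : ℝ) ^ j := by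
  subst h
  rw [show (2 * (i : ℤ)) - 2 * ((i + j : ℕ) : ℤ) = -((2 * j : ℕ) : ℤ) by push_cast; ring,
    zpow_neg, zpow_natCast, pow_mul, ← inv_pow]
  norm_num

lemma Ppoly_eq' (n : ℕ) (s t : ℝ) :
    Ppoly n s t = ∑ j ∈ range (n / 2 + 1), cc n j * s ^ (n - 2 * j) * t ^ (2 * j) := by
  rw [← Finset.sum_range_reflect]
  unfold Ppoly
  split_ifs with h
  · obtain ⟨m, rfl⟩ : ∃ m, n = 2 * m := ⟨n / 2, by omega⟩
    rw [show 2 * m / 2 = m by omega]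
    refine Finset.sum_congr rfl fun i hi => ?_
    obtain ⟨j, rfl⟩ := Nat.exists_eq_add_of_le (show i ≤ m by simp at hi; omega)
    unfold aEven cc
    rw [two_zpow_aux _ i j rfl, show i + j + 1 - 1 - i = j by omega,
      show i + j - i = j by omega, show 2 * (i + j) - 2 * j = 2 * i by omega,
      show 2 * (i + j) - j = i + j + i by omega, pow_add _ (2 * (i + j)), pow_mul]
    simp
  · obtain ⟨m, rfl⟩ : ∃ m, n = 2 * m + 1 := ⟨n / 2, by omega⟩
    rw [show (2 * m + 1) / 2 = m by omega]
    refine Finset.sum_congr rfl fun i hi => ?_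
    obtain ⟨j, rfl⟩ := Nat.exists_eq_add_of_le (show i ≤ m by simp at hi; omega)
    unfold aOdd cc
    rw [two_zpow_aux _ i j rfl, show i + j + 1 - 1 - i = j by omega,
      show i + j - i = j by omega, show 2 * (i + j) + 1 - 2 * j = 2 * i + 1 by omega,
      show 2 * (i + j) + 1 - j = i + j + i + 1 by omega,
      show 2 * (i + j) + 1 + j = 2 * (i + j) + (j + 1) by omega, pow_add _ (2 * (i + j)), pow_mul]
    simp

lemma Ppoly_eq (n N : ℕ) (hN : n / 2 < N) (s t : ℝ) :
    Ppoly n s t = ∑ j ∈ range N, cc n j * s ^ (n - 2 * j) * t ^ (2 * j) := by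
  rw [Ppoly_eq']
  apply Finset.sum_subset
  · intro x; simp; omega
  · intro x _ hx
    rw [cc_zero (by simp at hx; omega)]; simp

lemma Ppoly_deriv (n N : ℕ) (hN : n / 2 < N) (s t : ℝ) :
    deriv (fun s' => Ppoly n s' t) s =
      ∑ j ∈ range N, cc n j * (((n - 2 * j : ℕ) : ℝ) * s ^ (n - 2 * j - 1)) * t ^ (2 * j) := by
  simp_rw [Ppoly_eq n N hN]
  apply HasDerivAt.deriv
  apply HasDerivAt.fun_sum
  intro j _
  exact ((hasDerivAt_pow _ s).const_mul _).mul_const _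

theorem Ppoly_recurrence (m : ℕ) (s t : ℝ) :
    Ppoly (m + 1) s t =
      (s ^ 2 + t ^ 2) * deriv (fun s' => Ppoly m s' t) s - (2 * (m : ℝ) + 1) * s * Ppoly m s t := by
  have key : (s ^ 2 + t ^ 2) * deriv (fun s' => Ppoly m s' t) s
      - (2 * (m : ℝ) + 1) * s * Ppoly m s t =
      (∑ j ∈ range (m + 2), -((m : ℝ) + 2 * j + 1) * cc m j * s ^ (m + 1 - 2 * j) * t ^ (2 * j)) +
      ∑ j ∈ range (m + 1), ((m : ℝ) - 2 * j) * cc m j * s ^ (m + 1 - 2 * (j + 1)) *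
        t ^ (2 * (j + 1)) := by
    rw [add_mul, Ppoly_eq m (m + 2) (by omega)]
    nth_rewrite 1 [Ppoly_deriv m (m + 2) (by omega)]
    rw [Ppoly_deriv m (m + 1) (by omega), add_sub_right_comm, Finset.mul_sum, Finset.mul_sum,
      Finset.mul_sum, ← Finset.sum_sub_distrib]
    congr 1
    · refine Finset.sum_congr rfl fun j _ => ?_
      rcases lt_or_ge m (2 * j) with h | h
      · simp [cc_zero h]
      obtain ⟨k, hk⟩ := Nat.exists_eq_add_of_le h
      rw [show m - 2 * j = k by omega, show m + 1 - 2 * j = k + 1 by omega]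
      have : (m : ℝ) = 2 * j + k := by exact_mod_cast hk
      rw [this]
      rcases k with _ | k
      · simp; ring
      · simp only [Nat.add_sub_cancel]; push_cast; ring
    · refine Finset.sum_congr rfl fun j _ => ?_
      rcases lt_or_ge m (2 * j) with h | h
      · simp [cc_zero h]
      rw [show m + 1 - 2 * (j + 1) = m - 2 * j - 1 by omega, Nat.cast_sub h]
      push_cast
      ring
  rw [key, Ppoly_eq (m + 1) (m + 2) (by omega), Finset.sum_range_succ',
    Finset.sum_range_succ' (fun j => -((m : ℝ) + 2 * j + 1) * cc m j * s ^ (m + 1 - 2 * j) * t ^ (2 * j)) (m + 1),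
    add_right_comm (∑ k ∈ range (m + 1), _), ← Finset.sum_add_distrib, cc_rec0]
  congr 1
  · refine Finset.sum_congr rfl fun j _ => ?_
    rw [cc_rec]; push_cast; ring
  · simp
end

section
/- For every integer m ≥ 1, Σ_{i=0}^{m+1} a_{2(m+1),2i} / C(2m+2, m+1−i) = −(m+1) · Σ_{i=0}^{m} a_{2m+1,2i+1} / C(2m, m−i) − ((2m+1)/2) · Σ_{i=0}^{m} a_{2m+1,2i+1} / C(2m+1, m−i). -/
open Finset

lemma step_aux (n K : ℕ) (h : K ≤ n + 1) (x : ℝ) :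
    ∑ j ∈ range (K + 1), x ^ j * ((n + 2 - j).choose j : ℝ) =
      x * ∑ j ∈ range K, x ^ j * ((n - j).choose j : ℝ) +
        ∑ j ∈ range (K + 1), x ^ j * ((n + 1 - j).choose j : ℝ) := by
  rw [sum_range_succ', sum_range_succ' (fun j => x ^ j * ((n + 1 - j).choose j : ℝ)), mul_sum,
    ← add_assoc, ← sum_add_distrib]
  congr 1
  · apply sum_congr rfl
    intro j hj
    have hj' := mem_range.1 hj
    have e1 : n + 2 - (j + 1) = (n - j) + 1 := by omega
    have e2 : n + 1 - (j + 1) = n - j := by omega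
    rw [e1, e2, Nat.choose_succ_succ]
    push_cast
    ring

lemma closed_aux (m : ℕ) :
    ∑ j ∈ range (m + 1), (-1/4 : ℝ) ^ j * ((2 * m - j).choose j : ℝ) = (2 * m + 1) * (1/4) ^ m ∧
    ∑ j ∈ range (m + 1), (-1/4 : ℝ) ^ j * ((2 * m + 1 - j).choose j : ℝ) = (m + 1) * (1/4) ^ m := by
  induction m with
  | zero => simp
  | succ m ih =>
    obtain ⟨h1, h2⟩ := ih
    have s1 := step_aux (2 * m) (m + 1) (by omega) (-1/4)
    rw [h1, sum_range_succ (fun j => (-1/4 : ℝ) ^ j * ((2 * m + 1 - j).choose j : ℝ)), h2,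
      Nat.choose_eq_zero_of_lt (by omega : 2 * m + 1 - (m + 1) < m + 1)] at s1
    have s2 := step_aux (2 * m + 1) (m + 1) (by omega) (-1/4)
    rw [h2, s1] at s2
    constructor
    · refine Eq.trans s1 ?_
      push_cast
      ring
    · refine Eq.trans s2 ?_
      push_cast
      ring

lemma lucas_aux (n j : ℕ) (h : j + 1 ≤ n) :
    ((n + 1).choose (j + 1) : ℝ) * ((n + 1 - (j + 1)).choose (j + 1) : ℝ)
      / (n.choose (j + 1) : ℝ) =
    ((n + 1 - (j + 1)).choose (j + 1) : ℝ) + ((n - 1 - j).choose j : ℝ) := by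
  obtain ⟨d, rfl⟩ := Nat.exists_eq_add_of_le h
  have e1 : j + 1 + d + 1 - (j + 1) = d + 1 := by omega
  have e2 : j + 1 + d - 1 - j = d := by omega
  have a := Nat.choose_mul_succ_eq (j + 1 + d) (j + 1)
  have b := Nat.add_one_mul_choose_eq d j
  rw [e1] at a
  rw [e1, e2]
  have hpos : ((j + 1 + d).choose (j + 1) : ℝ) ≠ 0 := by
    exact_mod_cast (Nat.choose_pos (by omega)).ne'
  have hd : (d + 1 : ℝ) ≠ 0 := by positivity
  rw [div_eq_iff hpos]
  have a' : ((j + 1 + d).choose (j + 1) : ℝ) * (j + 1 + d + 1) =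
    ((j + 1 + d + 1).choose (j + 1) : ℝ) * (d + 1) := by exact_mod_cast a
  have b' : (d + 1 : ℝ) * (d.choose j : ℝ) = ((d + 1).choose (j + 1) : ℝ) * (j + 1) := by
    exact_mod_cast b
  apply mul_left_cancel₀ hd
  linear_combination (-((d + 1).choose (j + 1) : ℝ)) * a' - ((j + 1 + d).choose (j + 1) : ℝ) * b'

lemma pow_aux (m j : ℕ) (h : j ≤ m) :
    (2 : ℝ) ^ ((2 * ((m - j : ℕ) : ℤ)) - 2 * (m : ℤ)) = (1/4) ^ j := by
  have : (2 * ((m - j : ℕ) : ℤ)) - 2 * (m : ℤ) = -((2 * j : ℕ) : ℤ) := by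
    push_cast [Nat.cast_sub h]
    ring
  rw [this, zpow_neg, zpow_natCast, pow_mul, ← inv_pow]
  norm_num

lemma even_aux (m : ℕ) :
    ∑ i ∈ range (m + 1), aEven m i / (Nat.choose (2 * m) (m - i) : ℝ) =
      ((2 * m).factorial : ℝ) * ((2 * m + 1) * (1/4) ^ m) := by
  rw [← sum_range_reflect, ← (closed_aux m).1, mul_sum]
  apply sum_congr rfl
  intro j hj
  have hj' : j ≤ m := by have := mem_range.1 hj; omega
  have e0 : m + 1 - 1 - j = m - j := by omega
  have e1 : m - (m - j) = j := by omega
  have e2 : m + (m - j) = 2 * m - j := by omega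
  have hpos : ((2 * m).choose j : ℝ) ≠ 0 := by
    exact_mod_cast (Nat.choose_pos (by omega)).ne'
  rw [e0, aEven, pow_aux m j hj', e1, e2, div_eq_iff hpos,
    show (-1/4 : ℝ) = (-1) * (1/4) by norm_num, mul_pow]
  ring

lemma odd_term (m j : ℕ) (h : j ≤ m) :
    aOdd m (m - j) = -(((2 * m + 1).factorial : ℝ) * ((-1/4) ^ j *
      (((2 * m + 1).choose j : ℝ) * ((2 * m + 1 - j).choose j : ℝ)))) := by
  have e1 : m - (m - j) = j := by omega
  have e2 : m + (m - j) + 1 = 2 * m + 1 - j := by omega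
  rw [aOdd, pow_aux m j h, e1, e2, show (-1/4 : ℝ) = (-1) * (1/4) by norm_num, mul_pow]
  ring

lemma odd_aux (m : ℕ) :
    ∑ i ∈ range (m + 1), aOdd m i / (Nat.choose (2 * m + 1) (m - i) : ℝ) =
      -(((2 * m + 1).factorial : ℝ) * ((m + 1) * (1/4) ^ m)) := by
  rw [← sum_range_reflect, ← (closed_aux m).2, mul_sum, ← sum_neg_distrib]
  apply sum_congr rfl
  intro j hj
  have hj' : j ≤ m := by have := mem_range.1 hj; omega
  have e0 : m + 1 - 1 - j = m - j := by omega
  have e1 : m - (m - j) = j := by omega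
  have hpos : ((2 * m + 1).choose j : ℝ) ≠ 0 := by
    exact_mod_cast (Nat.choose_pos (by omega)).ne'
  rw [e0, odd_term m j hj', e1, div_eq_iff hpos]
  ring

lemma odd_aux2 (k : ℕ) :
    ∑ i ∈ range (k + 1 + 1), aOdd (k + 1) i / (Nat.choose (2 * (k + 1)) (k + 1 - i) : ℝ) =
      -(((2 * (k + 1) + 1).factorial : ℝ) * (1/4) ^ (k + 1)) := by
  have c1 := (closed_aux (k + 1)).2
  have c2 := (closed_aux k).2
  have key : ∑ i ∈ range (k + 1 + 1), aOdd (k + 1) i / (Nat.choose (2 * (k + 1)) (k + 1 - i) : ℝ)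
      = -(((2 * (k + 1) + 1).factorial : ℝ) * (
        ∑ j ∈ range (k + 1 + 1), (-1/4 : ℝ) ^ j * ((2 * (k + 1) + 1 - j).choose j : ℝ) +
        (-1/4) * ∑ j ∈ range (k + 1), (-1/4 : ℝ) ^ j * ((2 * k + 1 - j).choose j : ℝ))) := by
    rw [← sum_range_reflect, sum_range_succ', sum_range_succ'
      (fun j => (-1/4 : ℝ) ^ j * ((2 * (k + 1) + 1 - j).choose j : ℝ)), add_right_comm (_ : ℝ), mul_sum,
      ← sum_add_distrib, mul_add (_ : ℝ), neg_add, mul_sum, ← sum_neg_distrib]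
    congr 1
    · apply sum_congr rfl
      intro j hj
      have hj' : j + 1 ≤ k + 1 := by have := mem_range.1 hj; omega
      have e0 : k + 1 + 1 - 1 - (j + 1) = k + 1 - (j + 1) := by omega
      have e1 : k + 1 - (k + 1 - (j + 1)) = j + 1 := by omega
      have l := lucas_aux (2 * (k + 1)) j (by omega)
      have e2 : 2 * (k + 1) - 1 - j = 2 * k + 1 - j := by omega
      rw [e2] at l
      rw [e0, odd_term (k + 1) (j + 1) hj', e1, neg_div, mul_div_assoc, mul_div_assoc, l]
      ring
    · have := odd_term (k + 1) 0 (by omega)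
      simp at this ⊢
      rw [this]
  rw [key, c1, c2]
  push_cast
  ring

theorem sum_aEven_succ_div_choose_succ_eq (m : ℕ) (hm : 1 ≤ m) :
    ∑ i ∈ Finset.range (m + 2), aEven (m + 1) i / (Nat.choose (2 * m + 2) (m + 1 - i) : ℝ) =
      -((m : ℝ) + 1) * ∑ i ∈ Finset.range (m + 1), aOdd m i / (Nat.choose (2 * m) (m - i) : ℝ) -
        ((2 * (m : ℝ) + 1) / 2) *
          ∑ i ∈ Finset.range (m + 1), aOdd m i / (Nat.choose (2 * m + 1) (m - i) : ℝ) := by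
  have h1 := even_aux (m + 1)
  have h2 := odd_aux m
  obtain ⟨k, rfl⟩ : ∃ k, m = k + 1 := ⟨m - 1, by omega⟩
  have h3 := odd_aux2 k
  rw [h2, h3]
  refine Eq.trans h1 ?_
  rw [show 2 * (k + 1 + 1) = (2 * (k + 1) + 1) + 1 by ring, Nat.factorial_succ (2 * (k + 1) + 1)]
  push_cast
  ring
end

section
/- Let Ω = {y ∈ ℝ³ : y₂² + y₃² < 1, −1 < y₁ < 0} and, for each natural number j ≥ 1, let z_j = (1/j, 0, 0). For every fixed integer m ≥ 1 there exists a constant C > 0 such that for all j ≥ 1, | ∫_Ω (1/|y|) · (∂₁^{2m} (1/|y − z_j|)) · y₁^{2m−1} dy + π · ((2m−1)!/2^{2m−1}) · ln j | ≤ C, where ∂₁^{2m}(1/|y − z_j|) denotes the 2m-th partial derivative of the function y ↦ 1/|y − z_j| with respect to the first coordinate y₁, and |·| is the Euclidean norm on ℝ³. -/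
open MeasureTheory

/-- The open solid cylinder `Ω = {y ∈ ℝ³ : y₂² + y₃² < 1, −1 < y₁ < 0}`. -/
def cylOmega : Set (EuclideanSpace ℝ (Fin 3)) :=
  {y | (y 1) ^ 2 + (y 2) ^ 2 < 1 ∧ -1 < y 0 ∧ y 0 < 0}

/-- The singular point `z_j = (1/j, 0, 0)`. -/
noncomputable def zpt (j : ℕ) : EuclideanSpace ℝ (Fin 3) :=
  EuclideanSpace.single 0 (1 / (j : ℝ))

open scoped ContDiff

lemma smooth_param (g : ℝ × ℝ → ℝ) (U : Set (ℝ × ℝ)) (hU : IsOpen U) (hg : ContDiffOn ℝ ∞ g U) (n : ℕ) :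
    ContDiffOn ℝ ∞ (fun p : ℝ × ℝ => iteratedDeriv n (fun a => g (a, p.2)) p.1) U := by
  induction n with
  | zero => simpa using hg
  | succ n ih =>
    set G : ℝ × ℝ → ℝ := fun p => iteratedDeriv n (fun a => g (a, p.2)) p.1 with hG
    have h1 : ContDiffOn ℝ ∞ (fun p => fderiv ℝ G p (1, 0)) U :=
      (ih.fderiv_of_isOpen hU (by simp)).clm_apply contDiffOn_const
    refine h1.congr ?_
    intro p hp
    rw [iteratedDeriv_succ]
    have hd : HasFDerivAt G (fderiv ℝ G p) p :=
      ((ih.contDiffAt (hU.mem_nhds hp)).differentiableAt (by simp)).hasFDerivAt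
    have h2 : HasDerivAt (fun a : ℝ => (a, p.2)) ((1:ℝ), (0:ℝ)) p.1 :=
      (hasDerivAt_id p.1).prodMk (hasDerivAt_const p.1 p.2)
    exact (HasFDerivAt.comp_hasDerivAt (f := fun a : ℝ => (a, p.2)) p.1 hd h2).deriv

lemma exchange (g : ℝ × ℝ → ℝ) (hg : ContDiffOn ℝ ∞ g {p | p.1 < 0}) (n : ℕ) :
    ∀ a < 0, iteratedDeriv n (fun a => ∫ r in (0:ℝ)..1, g (a, r)) a =
      ∫ r in (0:ℝ)..1, iteratedDeriv n (fun a => g (a, r)) a := by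
  have hU : IsOpen {p : ℝ × ℝ | p.1 < 0} := isOpen_lt continuous_fst continuous_const
  induction n with
  | zero => intro a _; simp
  | succ n ih =>
    intro a ha
    rw [iteratedDeriv_succ]
    have hev : iteratedDeriv n (fun a => ∫ r in (0:ℝ)..1, g (a, r)) =ᶠ[nhds a]
      fun a => ∫ r in (0:ℝ)..1, iteratedDeriv n (fun a => g (a, r)) a := by
      filter_upwards [isOpen_Iio.mem_nhds (show a ∈ Set.Iio (0:ℝ) from ha)] with b hb using ih b hb
    rw [hev.deriv_eq]
    have hc := fun k => (smooth_param g _ hU hg k)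
    have hsl : ∀ k, ∀ b < 0, Continuous (fun r => iteratedDeriv k (fun a => g (a, r)) b) := by
      intro k b hb
      exact ContinuousOn.comp_continuous (f := fun r : ℝ => (b, r)) (hc k).continuousOn (by fun_prop) (fun r => hb)
    have hs : Set.Icc (2 * a) (a / 2) ∈ nhds a := Icc_mem_nhds (by linarith) (by linarith)
    obtain ⟨C, hC⟩ := (isCompact_Icc.prod (isCompact_Icc (a := (0:ℝ)) (b := 1))).exists_bound_of_continuousOn
      (s := Set.Icc (2 * a) (a / 2) ×ˢ Set.Icc (0:ℝ) 1)
      ((hc (n+1)).continuousOn.mono (fun p hp => by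
        have := hp.1.2
        simp only [Set.mem_ofPred_eq]; linarith))
    refine (intervalIntegral.hasDerivAt_integral_of_dominated_loc_of_deriv_le 
      (F := fun a r => iteratedDeriv n (fun a => g (a, r)) a)
      (F' := fun a r => iteratedDeriv (n+1) (fun a => g (a, r)) a) (bound := fun _ => C) hs ?_ ?_ ?_ ?_ ?_ ?_).2.deriv
    · filter_upwards [hs] with b hb
      exact (hsl n b (by linarith [hb.2])).aestronglyMeasurable
    · exact (hsl n a ha).intervalIntegrable _ _
    · exact (hsl (n+1) a ha).aestronglyMeasurable
    · refine Filter.Eventually.of_forall fun t ht b hb => ?_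
      rw [Set.uIoc_of_le zero_le_one] at ht
      exact hC (b, t) ⟨hb, ht.1.le, ht.2⟩
    · exact intervalIntegrable_const
    · refine Filter.Eventually.of_forall fun t ht b hb => ?_
      have hb0 : b < 0 := by linarith [hb.2]
      have hd : DifferentiableAt ℝ (fun p : ℝ × ℝ => iteratedDeriv n (fun a => g (a, p.2)) p.1) (b, t) :=
        ((hc n).contDiffAt (hU.mem_nhds hb0)).differentiableAt (by simp)
      have h2 : DifferentiableAt ℝ (fun a : ℝ => (a, t)) b := by fun_prop
      have := (DifferentiableAt.comp (f := fun a : ℝ => (a, t)) b hd h2).hasDerivAt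
      rw [iteratedDeriv_succ]
      exact this

noncomputable def ff (p : ℝ × ℝ) : ℝ := 1 / √(p.1 ^ 2 + p.2 ^ 2)

lemma ff_smooth : ContDiffOn ℝ ∞ ff {p | p.1 < 0} := by
  intro p hp
  have hp' : p.1 < 0 := hp
  have : 0 < p.1 ^ 2 + p.2 ^ 2 := by nlinarith [sq_nonneg p.2, mul_pos_of_neg_of_neg hp' hp']
  unfold ff
  refine ContDiffAt.contDiffWithinAt ?_
  refine ContDiffAt.div contDiffAt_const (ContDiffAt.sqrt (by fun_prop) this.ne') (by positivity)

noncomputable def hh (p : ℝ × ℝ) : ℝ := Real.log (√(p.2 ^ 2 + 1) + √(p.1 ^ 2 + 1))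

lemma hh_smooth : ContDiff ℝ ∞ hh := by
  unfold hh
  refine ContDiff.log ((ContDiff.sqrt (by fun_prop) ?_).add (ContDiff.sqrt (by fun_prop) ?_)) ?_
  · intro p; positivity
  · intro p; positivity
  · intro p; positivity

lemma int_formula (x a : ℝ) (hx : x < 0) (ha : a < 0) :
    ∫ r in (0:ℝ)..1, r / √(x ^ 2 + r ^ 2) * ff (a, r) = hh (a, x) - Real.log (x + a) := by
  have hx2 : 0 < x ^ 2 := by nlinarith
  have ha2 : 0 < a ^ 2 := by nlinarith
  have key : ∀ r : ℝ, HasDerivAt (fun r => Real.log (√(x ^ 2 + r ^ 2) + √(a ^ 2 + r ^ 2)))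
      (r / √(x ^ 2 + r ^ 2) * ff (a, r)) r := by
    intro r
    have h1 : 0 < x ^ 2 + r ^ 2 := by positivity
    have h2 : 0 < a ^ 2 + r ^ 2 := by positivity
    have d1 : HasDerivAt (fun r : ℝ => x ^ 2 + r ^ 2) (2 * r) r := by
      simpa using ((hasDerivAt_pow 2 r).const_add (x ^ 2))
    have d2 : HasDerivAt (fun r : ℝ => a ^ 2 + r ^ 2) (2 * r) r := by
      simpa using ((hasDerivAt_pow 2 r).const_add (a ^ 2))
    have s1 : 0 < √(x ^ 2 + r ^ 2) := by positivity
    have s2 : 0 < √(a ^ 2 + r ^ 2) := by positivity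
    have d3 : HasDerivAt (fun r : ℝ => √(x ^ 2 + r ^ 2) + √(a ^ 2 + r ^ 2))
      (2 * r / (2 * √(x ^ 2 + r ^ 2)) + 2 * r / (2 * √(a ^ 2 + r ^ 2))) r :=
      (d1.sqrt h1.ne').add (d2.sqrt h2.ne')
    have d4 := d3.log (by positivity)
    refine d4.congr_deriv ?_
    unfold ff
    simp only
    generalize √(x ^ 2 + r ^ 2) = A at *
    generalize √(a ^ 2 + r ^ 2) = B at *
    field_simp
    ring
  have hcont : Continuous (fun r : ℝ => r / √(x ^ 2 + r ^ 2) * ff (a, r)) := by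
    unfold ff
    refine (continuous_id.div (by fun_prop) ?_).mul (continuous_const.div (by fun_prop) ?_)
    · intro r; positivity
    · intro r; positivity
  rw [intervalIntegral.integral_eq_sub_of_hasDerivAt (fun r _ => key r) (hcont.intervalIntegrable _ _)]
  simp only [hh, one_pow, ne_eq, OfNat.ofNat_ne_zero, not_false_eq_true, zero_pow, add_zero]
  rw [Real.sqrt_sq_eq_abs, Real.sqrt_sq_eq_abs, abs_of_neg hx, abs_of_neg ha, ← Real.log_neg_eq_log (x + a)]
  ring_nf

lemma iter_log (x a : ℝ) (hx : x < 0) (ha : a < 0) (m : ℕ) (hm : 1 ≤ m) :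
    iteratedDeriv (2 * m) (fun a => Real.log (x + a)) a = - ((2 * m - 1).factorial : ℝ) / (x + a) ^ (2 * m) := by
  obtain ⟨k, rfl⟩ := Nat.exists_eq_add_of_le' hm
  rw [iteratedDeriv_comp_const_add]
  rw [show 2 * (k + 1) = (2 * k + 1) + 1 by ring, iteratedDeriv_succ', Real.deriv_log',
    iteratedDeriv_eq_iterate]
  simp only [Nat.add_sub_cancel]
  have := iter_deriv_inv (𝕜 := ℝ) (2 * k + 1) (x + a)
  rw [show (Inv.inv : ℝ → ℝ) = fun x => x⁻¹ from rfl] at *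
  rw [this]
  have hxa : x + a ≠ 0 := by linarith
  rw [show (-1 - ((2 * k + 1 : ℕ):ℤ)) = -((2 * k + 1 + 1 : ℕ) : ℤ) by push_cast; ring, zpow_neg, zpow_natCast]
  rw [pow_succ, pow_mul]
  simp
  ring

lemma inner_formula (x a : ℝ) (hx : x < 0) (ha : a < 0) (m : ℕ) (hm : 1 ≤ m) :
    ∫ r in (0:ℝ)..1, r / √(x ^ 2 + r ^ 2) * iteratedDeriv (2 * m) (fun a => ff (a, r)) a
     = iteratedDeriv (2 * m) (fun a => hh (a, x)) a + ((2 * m - 1).factorial : ℝ) / (x + a) ^ (2 * m) := by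
  have hx2 : 0 < x ^ 2 := by nlinarith
  have hg : ContDiffOn ℝ ∞ (fun p : ℝ × ℝ => p.2 / √(x ^ 2 + p.2 ^ 2) * ff p) {p | p.1 < 0} := by
    refine ContDiffOn.mul (ContDiff.contDiffOn ?_) ff_smooth
    refine ContDiff.div (by fun_prop) (ContDiff.sqrt (by fun_prop) ?_) ?_
    · intro p; positivity
    · intro p; positivity
  have h := exchange _ hg (2 * m) a ha
  simp only [iteratedDeriv_const_mul_field] at h
  rw [← h]
  have hev : (fun a => ∫ r in (0:ℝ)..1, r / √(x ^ 2 + r ^ 2) * ff (a, r)) =ᶠ[nhds a]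
      (fun a => hh (a, x) - Real.log (x + a)) := by
    filter_upwards [isOpen_Iio.mem_nhds (show a ∈ Set.Iio (0:ℝ) from ha)] with b hb
    exact int_formula x b hx hb
  rw [hev.iteratedDeriv_eq, iteratedDeriv_fun_sub, iter_log x a hx ha m hm]
  · ring
  · have : ContDiff ℝ ∞ (fun a => hh (a, x)) := hh_smooth.comp (by fun_prop)
    exact (this.contDiffAt).of_le (WithTop.coe_le_coe.2 le_top)
  · exact ContDiffAt.log (by fun_prop) (by linarith)

lemma J_bound (n : ℕ) : ∃ C, ∀ ε : ℝ, 0 < ε → ε ≤ 1 →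
    |(∫ x in (-1:ℝ)..0, x ^ n / (2 * x - ε) ^ (n + 1)) - Real.log ε / 2 ^ (n + 1)| ≤ C := by
  have hne : ∀ ε : ℝ, 0 < ε → ∀ x ∈ Set.uIcc (-1:ℝ) 0, 2 * x - ε ≠ 0 := by
    intro ε hε x hx
    rw [Set.uIcc_of_le (by norm_num)] at hx
    linarith [hx.2]
  have hint : ∀ ε : ℝ, 0 < ε → ∀ k l : ℕ,
      IntervalIntegrable (fun x : ℝ => x ^ k / (2 * x - ε) ^ l) volume (-1) 0 := by
    intro ε hε k l
    refine ContinuousOn.intervalIntegrable ?_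
    refine ContinuousOn.div (by fun_prop) (by fun_prop) ?_
    intro x hx; exact pow_ne_zero _ (hne ε hε x hx)
  have hd0 : ∀ (c x : ℝ), HasDerivAt (fun x : ℝ => 2 * x - c) 2 x := by
    intro c x
    simpa using ((hasDerivAt_id x).const_mul 2).sub_const c
  induction n with
  | zero =>
    refine ⟨Real.log 3, fun ε hε hε1 => ?_⟩
    have hder : ∀ x ∈ Set.uIcc (-1:ℝ) 0, HasDerivAt (fun x : ℝ => Real.log (2 * x - ε) / 2)
        (x ^ 0 / (2 * x - ε) ^ (0 + 1)) x := by
      intro x hx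
      have h := hne ε hε x hx
      refine (((hd0 ε x).log h).div_const 2).congr_deriv ?_
      rw [pow_zero, zero_add, pow_one]
      field_simp
    rw [intervalIntegral.integral_eq_sub_of_hasDerivAt hder (hint ε hε 0 (0 + 1))]
    have e1 : Real.log (2 * 0 - ε) = Real.log ε := by
      rw [show 2 * 0 - ε = - ε by ring, Real.log_neg_eq_log]
    have e2 : Real.log (2 * (-1) - ε) = Real.log (2 + ε) := by
      rw [← Real.log_neg_eq_log]; ring_nf
    rw [e1, e2]
    have h5 : Real.log (2 + ε) ≤ Real.log 3 := Real.log_le_log (by linarith) (by linarith)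
    have h6 : 0 ≤ Real.log (2 + ε) := Real.log_nonneg (by linarith)
    rw [show Real.log ε / 2 - Real.log (2 + ε) / 2 - Real.log ε / 2 ^ (0 + 1)
      = - (Real.log (2 + ε) / 2) by ring]
    rw [abs_neg, abs_of_nonneg (by linarith)]
    linarith
  | succ n ih =>
    obtain ⟨C, hC⟩ := ih
    refine ⟨C / 2 + 1, fun ε hε hε1 => ?_⟩
    have hder : ∀ x ∈ Set.uIcc (-1:ℝ) 0,
        HasDerivAt (fun x : ℝ => (x ^ (n+1) / (2 * x - ε) ^ (n+1)) / (2 * ((n:ℝ) + 1)))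
        ((1/2) * (x ^ n / (2 * x - ε) ^ (n + 1)) - x ^ (n+1) / (2 * x - ε) ^ (n + 1 + 1)) x := by
      intro x hx
      have h := hne ε hε x hx
      have h2 : HasDerivAt (fun x : ℝ => (2 * x - ε) ^ (n+1))
        (((n + 1 : ℕ) : ℝ) * (2 * x - ε) ^ n * 2) x := (hd0 ε x).pow (n+1)
      refine (((hasDerivAt_pow (n+1) x).fun_div h2 (pow_ne_zero _ h)).div_const
        (2 * ((n:ℝ) + 1))).congr_deriv ?_
      have hn : (n:ℝ) + 1 ≠ 0 := by positivity
      generalize 2 * x - ε = w at *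
      simp only [Nat.add_sub_cancel, Nat.cast_add, Nat.cast_one]
      field_simp
      ring
    have hFTC := intervalIntegral.integral_eq_sub_of_hasDerivAt hder
      (((hint ε hε n (n+1)).const_mul _).sub (hint ε hε (n+1) (n+1+1)))
    rw [intervalIntegral.integral_sub ((hint ε hε n (n+1)).const_mul _) (hint ε hε (n+1) (n+1+1)),
      intervalIntegral.integral_const_mul] at hFTC
    have hq : |((-1:ℝ) ^ (n+1) / (2 * (-1) - ε) ^ (n+1)) / (2 * ((n:ℝ) + 1))| ≤ 1 := by
      rw [← div_pow, abs_div, abs_pow]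
      have : |(-1:ℝ) / (2 * (-1) - ε)| ≤ 1 := by
        rw [abs_div, abs_neg, abs_one]
        rw [abs_of_neg (by linarith), div_le_one (by linarith)]; linarith
      have h7 := pow_le_one₀ (n := n + 1) (abs_nonneg _) this
      have h8 : (1:ℝ) ≤ |2 * ((n:ℝ) + 1)| := by
        rw [abs_of_pos (by positivity)]; have : (0:ℝ) ≤ n := by positivity
        linarith
      exact div_le_one_of_le₀ (h7.trans h8) (abs_nonneg _)
    simp only [ne_eq, Nat.add_eq_zero_iff, one_ne_zero, and_false, not_false_eq_true, zero_pow,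
      zero_div, zero_sub] at hFTC
    have := hC ε hε hε1
    rw [abs_le] at this hq ⊢
    have e : Real.log ε / 2 ^ (n + 1 + 1) = (Real.log ε / 2 ^ (n+1)) / 2 := by
      rw [pow_succ]; field_simp
    rw [e]
    constructor <;> linarith

noncomputable def eqv3 : EuclideanSpace ℝ (Fin 3) ≃ᵐ ℝ × (ℝ × ℝ) :=
  ((MeasurableEquiv.toLp 2 (Fin 3 → ℝ)).symm.trans
    (MeasurableEquiv.piFinSuccAbove (fun _ => ℝ) 0)).trans
    (MeasurableEquiv.prodCongr (MeasurableEquiv.refl ℝ) MeasurableEquiv.finTwoArrow)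

lemma eqv3_apply (y : EuclideanSpace ℝ (Fin 3)) : eqv3 y = (y 0, (y 1, y 2)) := rfl

lemma eqv3_mp : MeasurePreserving eqv3 volume volume := by
  have h1 := EuclideanSpace.volume_preserving_symm_measurableEquiv_toLp (Fin 3)
  have h2 := volume_preserving_piFinSuccAbove (fun _ : Fin 3 => ℝ) 0
  have h3 := (MeasurePreserving.id (volume : Measure ℝ)).prod (volume_preserving_finTwoArrow ℝ)
  exact h3.comp (h2.comp h1)

lemma radial_int (g : ℝ → ℝ) : ∫ p : ℝ × ℝ, g (√(p.1 ^ 2 + p.2 ^ 2)) =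
    2 * Real.pi * ∫ r in Set.Ioi (0:ℝ), r * g r := by
  rw [← integral_comp_polarCoord_symm]
  have h : ∀ p ∈ polarCoord.target, p.1 • g (√((polarCoord.symm p).1 ^ 2 + (polarCoord.symm p).2 ^ 2))
      = (p.1 * g p.1) * (fun _ : ℝ => (1:ℝ)) p.2 := by
    intro p hp
    rw [polarCoord_target] at hp
    have hp1 : 0 < p.1 := hp.1
    rw [polarCoord_symm_apply]
    simp only [smul_eq_mul, mul_one]
    congr 2
    rw [show (p.1 * Real.cos p.2) ^ 2 + (p.1 * Real.sin p.2) ^ 2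
      = p.1 ^ 2 * (Real.sin p.2 ^ 2 + Real.cos p.2 ^ 2) by ring, Real.sin_sq_add_cos_sq, mul_one,
      Real.sqrt_sq hp1.le]
  rw [setIntegral_congr_fun polarCoord.open_target.measurableSet h, polarCoord_target,
    Measure.volume_eq_prod, setIntegral_prod_mul (fun r => r * g r) (fun _ => (1:ℝ))]
  simp [Real.pi_pos.le]
  ring

lemma cyl_meas : MeasurableSet cylOmega := by
  have h0 : ∀ i, Continuous (fun y : EuclideanSpace ℝ (Fin 3) => y i) := fun i => by fun_prop
  refine IsOpen.measurableSet ?_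
  unfold cylOmega
  exact (isOpen_lt (((h0 1).pow 2).add ((h0 2).pow 2)) continuous_const).inter
    ((isOpen_lt continuous_const (h0 0)).inter (isOpen_lt (h0 0) continuous_const))

lemma cyl_int (Φ : ℝ → ℝ → ℝ)
    (hint : IntegrableOn (fun y : EuclideanSpace ℝ (Fin 3) => Φ (y 0) (√((y 1) ^ 2 + (y 2) ^ 2))) cylOmega) :
    ∫ y in cylOmega, Φ (y 0) (√((y 1) ^ 2 + (y 2) ^ 2)) =
      ∫ x in (-1:ℝ)..0, 2 * Real.pi * ∫ r in (0:ℝ)..1, r * Φ x r := by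
  classical
  set G : ℝ → ℝ → ℝ := fun x r => (Set.Ioo (-1:ℝ) 0).indicator (fun x => (Set.Iio (1:ℝ)).indicator (Φ x) r) x with hG
  have e : cylOmega.indicator (fun y : EuclideanSpace ℝ (Fin 3) => Φ (y 0) (√((y 1) ^ 2 + (y 2) ^ 2)))
      = fun y => (fun p : ℝ × (ℝ × ℝ) => G p.1 (√(p.2.1 ^ 2 + p.2.2 ^ 2))) (eqv3 y) := by
    funext y
    rw [eqv3_apply]
    simp only [hG, Set.indicator, cylOmega, Set.mem_ofPred_eq, Set.mem_Ioo, Set.mem_Iio]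
    have : √((y 1) ^ 2 + (y 2) ^ 2) < 1 ↔ (y 1) ^ 2 + (y 2) ^ 2 < 1 := by
      rw [Real.sqrt_lt' one_pos, one_pow]
    simp only [this]
    by_cases h1 : (y 1) ^ 2 + (y 2) ^ 2 < 1 <;> by_cases h2 : -1 < y 0 ∧ y 0 < 0 <;> simp [h1, h2]
  rw [← integrable_indicator_iff cyl_meas, e] at hint
  have hint2 := (eqv3_mp.integrable_comp_emb eqv3.measurableEmbedding
    (g := fun p : ℝ × (ℝ × ℝ) => G p.1 (√(p.2.1 ^ 2 + p.2.2 ^ 2)))).1 hint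
  rw [← integral_indicator cyl_meas, e, eqv3_mp.integral_comp eqv3.measurableEmbedding
    (fun p : ℝ × (ℝ × ℝ) => G p.1 (√(p.2.1 ^ 2 + p.2.2 ^ 2)))]
  rw [Measure.volume_eq_prod] at hint2 ⊢
  rw [integral_prod _ hint2]
  simp only [radial_int]
  rw [intervalIntegral.integral_of_le (by norm_num), integral_Ioc_eq_integral_Ioo,
    ← integral_indicator measurableSet_Ioo]
  congr 1
  funext x
  by_cases hx : x ∈ Set.Ioo (-1:ℝ) 0
  · rw [Set.indicator_of_mem hx]
    congr 1
    rw [intervalIntegral.integral_of_le (by norm_num), integral_Ioc_eq_integral_Ioo]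
    have : ∀ r, r * G x r = (Set.Iio (1:ℝ)).indicator (fun r => r * Φ x r) r := by
      intro r
      simp only [hG, Set.indicator_of_mem hx]
      by_cases hr : r ∈ Set.Iio (1:ℝ) <;> simp [hr]
    simp only [this]
    rw [setIntegral_indicator measurableSet_Iio, Set.Ioi_inter_Iio]
  · rw [Set.indicator_of_notMem hx]
    have : ∀ r, G x r = 0 := by
      intro r
      simp only [hG, Set.indicator_of_notMem hx]
    simp [this]

lemma norm_inv_int : IntegrableOn (fun y : EuclideanSpace ℝ (Fin 3) => 1 / ‖y‖) cylOmega := by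
  have h : IntegrableOn (fun y : EuclideanSpace ℝ (Fin 3) => 1 / ‖y‖) (Metric.ball 0 2) := by
    rw [integrableOn_fun_norm_addHaar volume (f := fun r => 1 / r)]
    have : IntegrableOn (fun y : ℝ => y) (Set.Ioo 0 2) :=
      (continuous_id.integrableOn_Icc).mono_set Set.Ioo_subset_Icc_self
    refine this.congr_fun ?_ measurableSet_Ioo
    intro y hy
    have := hy.1.ne'
    simp
    field_simp
  refine h.mono_set ?_
  intro y hy
  obtain ⟨h1, h2, h3⟩ := hy
  rw [mem_ball_zero_iff, EuclideanSpace.norm_eq, Real.sqrt_lt' (by norm_num)]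
  simp only [Fin.sum_univ_three, Real.norm_eq_abs, sq_abs]
  nlinarith

noncomputable def FF (n : ℕ) (p : ℝ × ℝ) : ℝ := iteratedDeriv n (fun a => ff (a, p.2)) p.1

lemma FF_cont (n : ℕ) : ContinuousOn (FF n) {p | p.1 < 0} :=
  (smooth_param ff _ (isOpen_lt continuous_fst continuous_const) ff_smooth n).continuousOn

lemma norm3 (y : EuclideanSpace ℝ (Fin 3)) : ‖y‖ = √((y 0) ^ 2 + (√((y 1) ^ 2 + (y 2) ^ 2)) ^ 2) := by
  rw [EuclideanSpace.norm_eq, Real.sq_sqrt (by positivity)]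
  simp only [Fin.sum_univ_three, Real.norm_eq_abs, sq_abs]
  ring_nf

lemma integrand_eq (n : ℕ) (j : ℕ) (y : EuclideanSpace ℝ (Fin 3)) :
    iteratedDeriv n (fun s : ℝ => 1 / ‖(y + s • EuclideanSpace.single 0 (1 : ℝ)) - zpt j‖) 0
      = FF n (y 0 - 1 / j, √((y 1) ^ 2 + (y 2) ^ 2)) := by
  have : (fun s : ℝ => 1 / ‖(y + s • EuclideanSpace.single 0 (1 : ℝ)) - zpt j‖)
      = fun s => (fun a => ff (a, √((y 1) ^ 2 + (y 2) ^ 2))) ((y 0 - 1 / j) + s) := by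
    funext s
    rw [norm3]
    simp only [ff, zpt]
    simp
    ring_nf
  rw [this, iteratedDeriv_comp_const_add n (fun a => ff (a, √((y 1) ^ 2 + (y 2) ^ 2))) (y 0 - 1 / j)]
  simp [FF]

lemma integrand_int (n k : ℕ) (ε : ℝ) (hε : 0 < ε) :
    IntegrableOn (fun y : EuclideanSpace ℝ (Fin 3) => 1 / ‖y‖ *
      FF n (y 0 - ε, √((y 1) ^ 2 + (y 2) ^ 2)) * (y 0) ^ k) cylOmega := by
  obtain ⟨C, hC⟩ := ((isCompact_Icc (a := -1 - ε) (b := -ε)).prod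
    (isCompact_Icc (a := (0:ℝ)) (b := 1))).exists_bound_of_continuousOn
      ((FF_cont n).mono (fun p hp => by
        have := hp.1.2
        simp only [Set.mem_ofPred_eq]; linarith))
  have hco : ContinuousOn (fun y : EuclideanSpace ℝ (Fin 3) =>
      FF n (y 0 - ε, √((y 1) ^ 2 + (y 2) ^ 2)) * (y 0) ^ k) cylOmega := by
    refine ContinuousOn.mul ?_ (by fun_prop)
    refine (FF_cont n).comp (f := fun y : EuclideanSpace ℝ (Fin 3) =>
      (y 0 - ε, √((y 1) ^ 2 + (y 2) ^ 2))) (by fun_prop) ?_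
    intro y hy
    have := hy.2.2
    simp only [Set.mem_ofPred_eq]; linarith
  have h := Integrable.mul_bdd (c := C) norm_inv_int (hco.aestronglyMeasurable cyl_meas) ?_
  · simp only [mul_assoc]
    exact h
  · refine (ae_restrict_iff' cyl_meas).2 (Filter.Eventually.of_forall fun y hy => ?_)
    obtain ⟨h1, h2, h3⟩ := hy
    have hF := hC (y 0 - ε, √((y 1) ^ 2 + (y 2) ^ 2)) ⟨⟨by simp only; linarith, by simp only; linarith⟩,
      Real.sqrt_nonneg _, Real.sqrt_le_one.2 h1.le⟩
    have hy1 : |y 0| ≤ 1 := by rw [abs_le]; constructor <;> linarith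
    rw [norm_mul, norm_pow, Real.norm_eq_abs (y 0)]
    calc _ ≤ ‖FF n (y 0 - ε, √((y 1) ^ 2 + (y 2) ^ 2))‖ * 1 := by
          gcongr; exact pow_le_one₀ (abs_nonneg _) hy1
      _ ≤ C := by simpa using hF

theorem exploding_integral_odd (m : ℕ) (hm : 1 ≤ m) :
    ∃ C > 0, ∀ j : ℕ, 1 ≤ j →
      |(∫ y in cylOmega,
            (1 / ‖y‖) *
              (iteratedDeriv (2 * m)
                (fun s : ℝ => 1 / ‖(y + s • EuclideanSpace.single 0 (1 : ℝ)) - zpt j‖) 0) *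
              (y 0) ^ (2 * m - 1)) +
          Real.pi * ((Nat.factorial (2 * m - 1) : ℝ) / 2 ^ (2 * m - 1)) * Real.log j| ≤ C := by
  obtain ⟨C, hC⟩ := J_bound (2 * m - 1)
  have hHc : Continuous (fun p : ℝ × ℝ => iteratedDeriv (2 * m) (fun a => hh (a, p.2)) p.1) := by
    have := (smooth_param hh _ isOpen_univ hh_smooth.contDiffOn (2 * m)).continuousOn
    rwa [continuousOn_univ] at this
  obtain ⟨D, hD⟩ := ((isCompact_Icc (a := (-2:ℝ)) (b := 0)).prod
    (isCompact_Icc (a := (-1:ℝ)) (b := 0))).exists_bound_of_continuousOn hHc.continuousOn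
  set K : ℝ := ((2 * m - 1).factorial : ℝ) with hK
  have hK0 : 0 ≤ K := by positivity
  refine ⟨2 * Real.pi * (|D| + K * |C|) + 1, by positivity, fun j hj => ?_⟩
  have hj0 : (0:ℝ) < j := by exact_mod_cast hj
  have hj1 : (1:ℝ) ≤ j := by exact_mod_cast hj
  have hlog : Real.log j = - Real.log (1 / j) := by rw [one_div, Real.log_inv, neg_neg]
  rw [hlog]
  simp only [integrand_eq]
  have hε : 0 < 1 / (j:ℝ) := by positivity
  have hε1 : 1 / (j:ℝ) ≤ 1 := by rw [div_le_one hj0]; exact hj1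
  generalize 1 / (j:ℝ) = ε at *
  have hI := integrand_int (2 * m) (2 * m - 1) ε hε
  have hJ := hC ε hε hε1
  simp only [norm3] at hI ⊢
  rw [cyl_int (fun x r => 1 / √(x ^ 2 + r ^ 2) * FF (2 * m) (x - ε, r) * x ^ (2 * m - 1)) hI]
  have hm2 : 2 * m - 1 + 1 = 2 * m := by omega
  rw [hm2] at hJ
  have step : ∫ x in (-1:ℝ)..0, 2 * Real.pi * ∫ r in (0:ℝ)..1,
      r * (1 / √(x ^ 2 + r ^ 2) * FF (2 * m) (x - ε, r) * x ^ (2 * m - 1))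
      = ∫ x in (-1:ℝ)..0, (2 * Real.pi) * (x ^ (2 * m - 1) *
        iteratedDeriv (2 * m) (fun a => hh (a, x)) (x - ε) +
        K * (x ^ (2 * m - 1) / (2 * x - ε) ^ (2 * m))) := by
    rw [intervalIntegral.integral_of_le (by norm_num), intervalIntegral.integral_of_le (by norm_num),
      integral_Ioc_eq_integral_Ioo, integral_Ioc_eq_integral_Ioo]
    refine setIntegral_congr_fun measurableSet_Ioo ?_
    intro x hx
    have hx0 : x < 0 := hx.2
    have h := inner_formula x (x - ε) hx0 (by linarith) m hm
    simp only
    congr 1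
    have e : ∀ r, r * (1 / √(x ^ 2 + r ^ 2) * FF (2 * m) (x - ε, r) * x ^ (2 * m - 1))
       = (r / √(x ^ 2 + r ^ 2) * iteratedDeriv (2 * m) (fun a => ff (a, r)) (x - ε)) * x ^ (2 * m - 1) := by
      intro r; simp only [FF]; ring
    simp only [e]
    rw [intervalIntegral.integral_mul_const, h]
    ring
  rw [step, intervalIntegral.integral_const_mul]
  have i1 : IntervalIntegrable (fun x : ℝ => x ^ (2 * m - 1) *
        iteratedDeriv (2 * m) (fun a => hh (a, x)) (x - ε)) volume (-1) 0 := by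
    refine Continuous.intervalIntegrable ?_ _ _
    exact (continuous_pow _).mul (hHc.comp (f := fun x : ℝ => (x - ε, x)) (by fun_prop))
  have i2 : IntervalIntegrable (fun x : ℝ => K * (x ^ (2 * m - 1) / (2 * x - ε) ^ (2 * m))) volume (-1) 0 := by
    refine ContinuousOn.intervalIntegrable ?_
    refine continuousOn_const.mul (ContinuousOn.div (by fun_prop) (by fun_prop) ?_)
    intro x hx
    rw [Set.uIcc_of_le (by norm_num)] at hx
    exact pow_ne_zero _ (by linarith [hx.2])
  rw [intervalIntegral.integral_add i1 i2, intervalIntegral.integral_const_mul]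
  have b1 : |∫ x in (-1:ℝ)..0, x ^ (2 * m - 1) *
        iteratedDeriv (2 * m) (fun a => hh (a, x)) (x - ε)| ≤ |D| := by
    have := intervalIntegral.norm_integral_le_of_norm_le_const (a := (-1:ℝ)) (b := 0) (C := |D|)
      (f := fun x : ℝ => x ^ (2 * m - 1) * iteratedDeriv (2 * m) (fun a => hh (a, x)) (x - ε)) ?_
    · simpa using this
    · intro x hx
      rw [Set.uIoc_of_le (by norm_num)] at hx
      have h1 := hx.1
      have h2 := hx.2
      have hF := hD (x - ε, x) ⟨⟨by simp only; linarith, by simp only; linarith⟩, h1.le, h2⟩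
      have hy1 : |x| ≤ 1 := by rw [abs_le]; constructor <;> linarith
      rw [norm_mul, norm_pow, Real.norm_eq_abs x]
      calc _ ≤ 1 * ‖iteratedDeriv (2 * m) (fun a => hh (a, x)) (x - ε)‖ := by
            gcongr; exact pow_le_one₀ (abs_nonneg _) hy1
        _ ≤ |D| := by rw [one_mul]; exact hF.trans (le_abs_self D)
  generalize (∫ x in (-1:ℝ)..0, x ^ (2 * m - 1) *
        iteratedDeriv (2 * m) (fun a => hh (a, x)) (x - ε)) = A at *
  generalize (∫ x in (-1:ℝ)..0, x ^ (2 * m - 1) / (2 * x - ε) ^ (2 * m)) = B at *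
  have hp : (2:ℝ) ^ (2 * m) = 2 * 2 ^ (2 * m - 1) := by rw [← pow_succ', hm2]
  have e : 2 * Real.pi * (A + K * B) + Real.pi * (K / 2 ^ (2 * m - 1)) * -Real.log ε
      = 2 * Real.pi * (A + K * (B - Real.log ε / 2 ^ (2 * m))) := by
    rw [hp]; field_simp; ring
  rw [e, abs_mul, abs_of_pos (by positivity : (0:ℝ) < 2 * Real.pi)]
  have b2 : |A + K * (B - Real.log ε / 2 ^ (2 * m))| ≤ |D| + K * |C| := by
    refine (abs_add_le _ _).trans (add_le_add b1 ?_)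
    rw [abs_mul, abs_of_nonneg hK0]
    exact mul_le_mul_of_nonneg_left (hJ.trans (le_abs_self C)) hK0
  have := mul_le_mul_of_nonneg_left b2 (by positivity : (0:ℝ) ≤ 2 * Real.pi)
  linarith
end
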